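/- Let G and H be da-hypomorphic digraphs. Then G is isomorphic to H if and only if there exist distinct vertices u, v of G and distinct vertices u′, v′ of H with dt_G(u) = dt_H(u′) and dt_G(v) = dt_H(v′), together with an isomorphism φ from the digraph obtained from G by deleting all arcs between u and v to the digraph obtained from H by deleting all arcs between u′ and v′, such that φ(u) = u′ and φ(v) = v′ (i.e., if and only if a pair of dacards in their common dadeck is dapasted isomorphically in both G and H). -/

import Mathlib

/-- An isomorphism between two digraphs (given as arc relations) is a vertex bijection
preserving the arc relation in both directions. -/
def DIso {V W : Type*} (D : V → V → Prop) (E : W → W → Prop) : Prop :=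
  ∃ f : V ≃ W, ∀ x y, D x y ↔ E (f x) (f y)

/-- The card of a digraph `D` obtained by deleting the vertex `v`. -/
def dCard {V : Type*} (D : V → V → Prop) (v : V) :
    {x : V // x ≠ v} → {x : V // x ≠ v} → Prop :=
  fun x y => D x.1 y.1

/-- Two digraphs on `Fin n` are hypomorphic if some bijection of their vertex sets
matches each card of one with an isomorphic card of the other. -/
def DHypomorphic {n : ℕ} (D E : Fin n → Fin n → Prop) : Prop :=
  ∃ σ : Fin n ≃ Fin n, ∀ v, DIso (dCard D v) (dCard E (σ v))

/-- First degree: the number of out-neighbors of `v`. -/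
noncomputable def aDeg {V : Type*} (D : V → V → Prop) (v : V) : ℕ :=
  Nat.card {w : V // D v w ∧ ¬ D w v}

/-- Second degree: the number of in-neighbors of `v`. -/
noncomputable def bDeg {V : Type*} (D : V → V → Prop) (v : V) : ℕ :=
  Nat.card {w : V // D w v ∧ ¬ D v w}

/-- Third degree: the number of strong neighbors of `v`. -/
noncomputable def cDeg {V : Type*} (D : V → V → Prop) (v : V) : ℕ :=
  Nat.card {w : V // D v w ∧ D w v}

/-- The degree triple of a vertex. -/
noncomputable def degTriple {V : Type*} (D : V → V → Prop) (v : V) : ℕ × ℕ × ℕ :=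
  (aDeg D v, bDeg D v, cDeg D v)

/-- Two digraphs on `Fin n` are da-hypomorphic if some bijection of their vertex sets
matches each card of one with an isomorphic card of the other, the deleted vertices
having the same degree triple. -/
def DaHypomorphic {n : ℕ} (D E : Fin n → Fin n → Prop) : Prop :=
  ∃ σ : Fin n ≃ Fin n, ∀ v, DIso (dCard D v) (dCard E (σ v)) ∧
    degTriple D v = degTriple E (σ v)

/-- The digraph obtained from `D` by deleting all arcs between `u` and `v`. -/
def delPair {V : Type*} (D : V → V → Prop) (u v : V) : V → V → Prop :=
  fun x y => D x y ∧ ¬((x = u ∧ y = v) ∨ (x = v ∧ y = u))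

/-- A bijection carrying `P` to `Q` away from one point `v`, where `P` and `Q` hold equally
often, also carries `P` to `Q` at `v`. -/
theorem iff_at_of_card_eq {V W : Type*} [Finite V] {P : V → Prop} {Q : W → Prop} (f : V ≃ W)
    {v : V} (hcard : Nat.card {x // P x} = Nat.card {y // Q y})
    (h : ∀ x, x ≠ v → (P x ↔ Q (f x))) : P v ↔ Q (f v) := by
  have hQ : Nat.card {x // Q (f x)} = Nat.card {y // Q y} :=
    Nat.card_congr (f.subtypeEquiv fun _ => Iff.rfl)
  have key : ∀ A B : V → Prop, Nat.card {x // A x} = Nat.card {x // B x} →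
      (∀ x, x ≠ v → (A x ↔ B x)) → A v → B v := by
    intro A B hAB hne hA
    have hsub : {x | B x} ⊆ {x | A x} := by
      intro x hx
      by_cases hxv : x = v
      · exact hxv ▸ hA
      · exact (hne x hxv).2 hx
    have heq : {x | B x} = {x | A x} :=
      Set.eq_of_subset_of_ncard_le hsub hAB.le (Set.toFinite _)
    exact heq.symm.subset hA
  exact ⟨key P (fun x => Q (f x)) (hcard.trans hQ.symm) h,
    key (fun x => Q (f x)) P (hQ.trans hcard.symm) fun x hx => (h x hx).symm⟩

/-- A bijection preserving all adjacencies of `u` except possibly those with `v`, and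
preserving the degree triple of `u`, preserves the adjacencies between `u` and `v`. -/
theorem arcs_iff_of_degTriple_eq {V W : Type*} [Finite V] {D : V → V → Prop}
    {E : W → W → Prop} (f : V ≃ W) {u v : V} (hdeg : degTriple D u = degTriple E (f u))
    (hout : ∀ w, w ≠ v → (D u w ↔ E (f u) (f w)))
    (hin : ∀ w, w ≠ v → (D w u ↔ E (f w) (f u))) :
    (D u v ↔ E (f u) (f v)) ∧ (D v u ↔ E (f v) (f u)) := by
  simp only [degTriple, Prod.mk.injEq] at hdeg
  obtain ⟨ha, hb, hc⟩ := hdeg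
  have a := iff_at_of_card_eq f (v := v) ha fun w hw => by rw [hout w hw, hin w hw]
  have b := iff_at_of_card_eq f (v := v) hb fun w hw => by rw [hout w hw, hin w hw]
  have c := iff_at_of_card_eq f (v := v) hc fun w hw => by rw [hout w hw, hin w hw]
  tauto

/-- Isomorphisms preserve degree triples. -/
theorem degTriple_eq_of_iso {V W : Type*} {D : V → V → Prop} {E : W → W → Prop} (f : V ≃ W)
    (hf : ∀ x y, D x y ↔ E (f x) (f y)) (v : V) : degTriple D v = degTriple E (f v) := by
  simp only [degTriple, Prod.mk.injEq]
  refine ⟨?_, ?_, ?_⟩ <;>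
    exact Nat.card_congr (f.subtypeEquiv fun w => by rw [hf v w, hf w v])

/-- Theorem 5.8, digraph case: da-hypomorphic digraphs `G` and `H` (on at least two
vertices) are isomorphic iff a pair of dacards in their common dadeck is dapasted
isomorphically in both: there are distinct `u, v` in `G` and distinct `u', v'` in `H`
with matching degree triples and an isomorphism from `G` minus the arcs between `u, v`
to `H` minus the arcs between `u', v'` sending `u ↦ u'` and `v ↦ v'`. -/
theorem stmt16 {n : ℕ} (hn : 2 ≤ n) (G H : Fin n → Fin n → Prop)
    (hG : Irreflexive G) (hH : Irreflexive H) (hda : DaHypomorphic G H) :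
    DIso G H ↔
    ∃ u v : Fin n, u ≠ v ∧ ∃ u' v' : Fin n, u' ≠ v' ∧
      degTriple G u = degTriple H u' ∧ degTriple G v = degTriple H v' ∧
      ∃ φ : Fin n ≃ Fin n,
        (∀ x y, delPair G u v x y ↔ delPair H u' v' (φ x) (φ y)) ∧
        φ u = u' ∧ φ v = v' := by
  constructor
  · rintro ⟨f, hf⟩
    have hne : (⟨0, by omega⟩ : Fin n) ≠ ⟨1, by omega⟩ := by simp
    refine ⟨_, _, hne, f _, f _, f.injective.ne hne, degTriple_eq_of_iso f hf _,
      degTriple_eq_of_iso f hf _, f, fun x y => ?_, rfl, rfl⟩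
    simp only [delPair, hf x y, f.injective.eq_iff]
  · rintro ⟨u, v, huv, _, _, -, hu, -, φ, hφ, rfl, rfl⟩
    simp only [delPair, φ.injective.eq_iff] at hφ
    have hoff : ∀ x y, ¬((x = u ∧ y = v) ∨ (x = v ∧ y = u)) → (G x y ↔ H (φ x) (φ y)) :=
      fun x y hxy => by simpa only [hxy, not_false_eq_true, and_true] using hφ x y
    obtain ⟨h₁, h₂⟩ := arcs_iff_of_degTriple_eq φ hu
      (fun w hw => hoff u w (by tauto)) (fun w hw => hoff w u (by tauto))
    refine ⟨φ, fun x y => ?_⟩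
    by_cases hxy : (x = u ∧ y = v) ∨ (x = v ∧ y = u)
    · rcases hxy with ⟨rfl, rfl⟩ | ⟨rfl, rfl⟩
      · exact h₁
      · exact h₂
    · exact hoff x y hxy
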